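/- If a flat frame F = (W, ≼, R) is pointwise downward directed, i.e. for every w and all v, u ∈ R[w] there exists s ∈ R[w] with s ≼ v and s ≼ u, then F validates the axiom di := ((p⇛r)∧(q⇛r))→((p∨q)⇛r). -/

import Mathlib

/-- Formulas of the language `L⇛`. -/
inductive Fml : Type where
  | var : Nat → Fml
  | top : Fml
  | bot : Fml
  | and : Fml → Fml → Fml
  | or  : Fml → Fml → Fml
  | imp : Fml → Fml → Fml
  | sto : Fml → Fml → Fml
deriving DecidableEq

/-- Uniform substitution. -/
def Fml.subst (σ : Nat → Fml) : Fml → Fml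
  | .var p => σ p
  | .top => .top
  | .bot => .bot
  | .and φ ψ => .and (φ.subst σ) (ψ.subst σ)
  | .or φ ψ => .or (φ.subst σ) (ψ.subst σ)
  | .imp φ ψ => .imp (φ.subst σ) (ψ.subst σ)
  | .sto φ ψ => .sto (φ.subst σ) (ψ.subst σ)

/-- Conjunction `φ₁ ∧ ⋯ ∧ φₙ` of a list of formulas (`⊤` for the empty list). -/
def Fml.conj : List Fml → Fml
  | [] => .top
  | [φ] => φ
  | φ :: ψ :: rest => .and φ (Fml.conj (ψ :: rest))

/-- Disjunction `φ₁ ∨ ⋯ ∨ φₙ` of a list of formulas (`⊥` for the empty list). -/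
def Fml.disj : List Fml → Fml
  | [] => .bot
  | [φ] => φ
  | φ :: ψ :: rest => .or φ (Fml.disj (ψ :: rest))

/-- A flat frame: a nonempty set of worlds with a preorder `≼` and a relation `R`. -/
structure FlatFrame : Type 1 where
  W : Type
  ne : Nonempty W
  le : W → W → Prop
  le_refl : ∀ w, le w w
  le_trans : ∀ ⦃w v u⦄, le w v → le v u → le w u
  R : W → W → Prop

/-- A valuation is admissible if every proposition letter denotes an upset. -/
def FlatFrame.IsUpset (F : FlatFrame) (V : Nat → F.W → Prop) : Prop :=
  ∀ p ⦃w v⦄, F.le w v → V p w → V p v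

/-- Truth of a formula at a world of a flat model: the usual intuitionistic Kripke
clauses over `≼`, and `w ⊨ φ⇛ψ` iff for every `w' ≽ w`, `R[w'] ⊆ ⟦φ⟧` implies
`R[w'] ⊆ ⟦ψ⟧`. -/
def FlatFrame.sat (F : FlatFrame) (V : Nat → F.W → Prop) : Fml → F.W → Prop
  | .var p, w => V p w
  | .top, _ => True
  | .bot, _ => False
  | .and φ ψ, w => F.sat V φ w ∧ F.sat V ψ w
  | .or φ ψ, w => F.sat V φ w ∨ F.sat V ψ w
  | .imp φ ψ, w => ∀ v, F.le w v → F.sat V φ v → F.sat V ψ v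
  | .sto φ ψ, w => ∀ w', F.le w w' →
      (∀ v, F.R w' v → F.sat V φ v) → ∀ v, F.R w' v → F.sat V ψ v

/-- A flat frame validates the consecution `Γ ⇒ φ` if in every model on it, every
world satisfying all formulas of `Γ` satisfies `φ`. -/
def FlatFrame.ValidCons (F : FlatFrame) (Γ : Set Fml) (φ : Fml) : Prop :=
  ∀ V, F.IsUpset V → ∀ w, (∀ ψ ∈ Γ, F.sat V ψ w) → F.sat V φ w

/-- A flat frame validates a formula if it is true at every world in every model on it. -/
def FlatFrame.ValidFml (F : FlatFrame) (φ : Fml) : Prop :=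
  ∀ V, F.IsUpset V → ∀ w, F.sat V φ w

/-- `em := p ∨ ¬p` (where `¬φ` abbreviates `φ→⊥`). -/
def emFml : Fml := .or (.var 0) (.imp (.var 0) .bot)
/-- `t□ := (⊤⇛p)→p`. -/
def tbFml : Fml := .imp (.sto .top (.var 0)) (.var 0)
/-- `str := (p→q)→(p⇛q)`. -/
def strFml : Fml := .imp (.imp (.var 0) (.var 1)) (.sto (.var 0) (.var 1))
/-- `p_a := (p⇛q)→(⊤⇛(p⇛q))`. -/
def paFml : Fml := .imp (.sto (.var 0) (.var 1)) (.sto .top (.sto (.var 0) (.var 1)))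
/-- `4a := p⇛(⊤⇛p)`. -/
def fourAFml : Fml := .sto (.var 0) (.sto .top (.var 0))
/-- `di := ((p⇛r)∧(q⇛r))→((p∨q)⇛r)`. -/
def diFml : Fml := .imp (.and (.sto (.var 0) (.var 2)) (.sto (.var 1) (.var 2)))
    (.sto (.or (.var 0) (.var 1)) (.var 2))

/-- every pointwise downward directed flat frame validates
`di := ((p⇛r)∧(q⇛r))→((p∨q)⇛r)`. -/
theorem downward_directed_validates_di (F : FlatFrame)
    (h : ∀ w v u : F.W, F.R w v → F.R w u →
      ∃ s, F.R w s ∧ F.le s v ∧ F.le s u) :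
    F.ValidFml diFml := by
  rintro V hV w x - ⟨hp, hq⟩ w' hw' hpq v hv
  by_cases hP : ∀ u, F.R w' u → V 0 u
  · exact hp w' hw' hP v hv
  · refine hq w' hw' (fun u hu => ?_) v hv
    push Not at hP
    obtain ⟨t, ht, htp⟩ := hP
    obtain ⟨s, hs, hst, hsu⟩ := h w' t u ht hu
    rcases hpq s hs with h0 | h1
    · exact absurd (hV 0 hst h0) htp
    · exact hV 1 hsu h1
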